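/- arXiv:0707.0372 — 3 statements merged into one kernel-verified Lean document; each statement's English description precedes it below -/
import Mathlib

section
/- Let R be a commutative ring, n ∈ ℕ, and d : Fin n → ℤ. For d-triangular matrices M, M′ ∈ M_n(R) and any t ∈ R one has: (1) ψ_t(M · M′) = ψ_t(M) · ψ_t(M′); (2) ψ_1(M) = M; (3) ψ_0(M) is the block-diagonal part of M, i.e., ψ_0(M) i j = M i j if d i = d j and ψ_0(M) i j = 0 otherwise. -/
/-- A matrix `M` is `d`-triangular if `M i j = 0` whenever `d j < d i`. -/
def DTriangular {R : Type*} [CommRing R] {n : ℕ} (d : Fin n → ℤ)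
    (M : Matrix (Fin n) (Fin n) R) : Prop :=
  ∀ i j, d j < d i → M i j = 0

/-- The deformation `ψ t` of a matrix: `ψ t M i j = t ^ (d j - d i) * M i j` when
`d i ≤ d j`, and `0` otherwise. -/
def psiDeform {R : Type*} [CommRing R] {n : ℕ} (d : Fin n → ℤ) (t : R)
    (M : Matrix (Fin n) (Fin n) R) : Matrix (Fin n) (Fin n) R :=
  Matrix.of fun i j => if d i ≤ d j then t ^ (d j - d i).toNat * M i j else 0

/-- For `d`-triangular matrices `M`, `M'` over a commutative ring and any `t`:
(1) `ψ t` is multiplicative, `ψ t (M * M') = ψ t M * ψ t M'`;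
(2) `ψ 1 M = M`; and
(3) `ψ 0 M` is the block-diagonal part of `M`. -/
theorem psiDeform_mul_one_zero {R : Type*} [CommRing R] {n : ℕ} (d : Fin n → ℤ)
    (M M' : Matrix (Fin n) (Fin n) R)
    (hM : DTriangular d M) (hM' : DTriangular d M') (t : R) :
    psiDeform d t (M * M') = psiDeform d t M * psiDeform d t M' ∧
    psiDeform d (1 : R) M = M ∧
    (∀ i j, psiDeform d (0 : R) M i j = if d i = d j then M i j else 0) := by
  refine ⟨?_, ?_, ?_⟩
  · ext i j
    simp only [psiDeform, Matrix.of_apply, Matrix.mul_apply]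
    split_ifs with hij
    · rw [Finset.mul_sum]
      refine Finset.sum_congr rfl fun k _ => ?_
      by_cases h1 : d i ≤ d k
      · by_cases h2 : d k ≤ d j
        · have e : (d j - d i).toNat = (d k - d i).toNat + (d j - d k).toNat := by omega
          rw [if_pos h1, if_pos h2, e, pow_add]
          ring
        · rw [if_neg h2, hM' k j (not_le.mp h2)]
          simp
      · rw [if_neg h1, hM i k (not_le.mp h1)]
        simp
    · symm
      refine Finset.sum_eq_zero fun k _ => ?_
      by_cases h1 : d i ≤ d k
      · have h2 : ¬ d k ≤ d j := fun h => hij (h1.trans h)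
        rw [if_neg h2, mul_zero]
      · rw [if_neg h1, zero_mul]
  · ext i j
    simp only [psiDeform, Matrix.of_apply, one_pow, one_mul]
    split_ifs with h
    · rfl
    · exact (hM i j (not_le.mp h)).symm
  · intro i j
    simp only [psiDeform, Matrix.of_apply]
    by_cases h : d i = d j
    · simp [h]
    · rw [if_neg h]
      split_ifs with h'
      · have e : (d j - d i).toNat ≠ 0 := by omega
        rw [zero_pow e, zero_mul]
      · rfl
end

section
/- Let F be a field, Γ a group, n ∈ ℕ, d : Fin n → ℤ, and ρ : Γ → GL_n(F) a group homomorphism such that ρ(g) is d-triangular for every g ∈ Γ. Define η(g) ∈ M_n(F[X]) by η(g) i j = X^{d j − d i} · ρ(g) i j when d j ≥ d i and η(g) i j = 0 otherwise. Then each η(g) is invertible over F[X] and η : Γ → GL_n(F[X]) is a group homomorphism; moreover, entrywise evaluation of the variable X at 1 recovers ρ, and entrywise evaluation at 0 yields the block-diagonal (associated-graded) representation g ↦ (the matrix with entries ρ(g) i j when d i = d j and 0 otherwise), which is again a group homomorphism Γ → GL_n(F). -/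
open Polynomial in
/-- Let `ρ : Γ → GL n F` be a representation all of whose values are `d`-triangular
(`ρ g i j = 0` when `d j < d i`).  Then the entrywise deformation
`η g i j = X ^ (d j - d i) * ρ g i j` (for `d i ≤ d j`, and `0` otherwise) takes
values in `GL n F[X]` and is a group homomorphism `Γ →* GL n F[X]`; evaluation of
`X` at `1` recovers `ρ`, and evaluation at `0` yields the block-diagonal
(associated-graded) representation, which is again a group homomorphism
`Γ →* GL n F`. -/
theorem exists_polynomial_deformation_of_triangular_representation
    {F : Type*} [Field F] {Γ : Type*} [Group Γ] {n : ℕ} (d : Fin n → ℤ)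
    (ρ : Γ →* Matrix.GeneralLinearGroup (Fin n) F)
    (htri : ∀ (g : Γ) (i j : Fin n), d j < d i →
      (ρ g : Matrix (Fin n) (Fin n) F) i j = 0) :
    ∃ η : Γ →* Matrix.GeneralLinearGroup (Fin n) (Polynomial F),
      (∀ (g : Γ) (i j : Fin n),
        (η g : Matrix (Fin n) (Fin n) (Polynomial F)) i j =
          if d i ≤ d j then
            X ^ (d j - d i).toNat * C ((ρ g : Matrix (Fin n) (Fin n) F) i j)
          else 0) ∧
      (∀ g : Γ, (η g : Matrix (Fin n) (Fin n) (Polynomial F)).map (eval (1 : F)) =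
        (ρ g : Matrix (Fin n) (Fin n) F)) ∧
      ∃ ρ₀ : Γ →* Matrix.GeneralLinearGroup (Fin n) F,
        (∀ g : Γ, (η g : Matrix (Fin n) (Fin n) (Polynomial F)).map (eval (0 : F)) =
          (ρ₀ g : Matrix (Fin n) (Fin n) F)) ∧
        (∀ (g : Γ) (i j : Fin n), (ρ₀ g : Matrix (Fin n) (Fin n) F) i j =
          if d i = d j then (ρ g : Matrix (Fin n) (Fin n) F) i j else 0) := by
  classical
  let m : Γ →* Matrix (Fin n) (Fin n) (Polynomial F) :=
    { toFun := fun g => Matrix.of fun i j =>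
        if d i ≤ d j then
          X ^ (d j - d i).toNat * C ((ρ g : Matrix (Fin n) (Fin n) F) i j)
        else 0
      map_one' := by
        ext1 i j
        by_cases h : i = j
        · subst h
          simp
        · simp [h]
      map_mul' := by
        intro g h
        ext1 i j
        simp only [Matrix.of_apply, Matrix.mul_apply, map_mul, Units.val_mul]
        by_cases hij : d i ≤ d j
        · rw [if_pos hij, map_sum, Finset.mul_sum]
          refine Finset.sum_congr rfl fun k _ => ?_
          by_cases h1 : d i ≤ d k
          · by_cases h2 : d k ≤ d j
            · rw [if_pos h1, if_pos h2]
              have e : (d j - d i).toNat = (d k - d i).toNat + (d j - d k).toNat := by omega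
              rw [e, pow_add, map_mul]
              ring
            · rw [if_neg h2, htri h k j (not_le.mp h2)]
              simp
          · rw [if_neg h1, htri g i k (not_le.mp h1)]
            simp
        · rw [if_neg hij]
          symm
          refine Finset.sum_eq_zero fun k _ => ?_
          by_cases h1 : d i ≤ d k
          · have h2 : ¬ d k ≤ d j := fun h2 => hij (h1.trans h2)
            rw [if_neg h2, mul_zero]
          · rw [if_neg h1, zero_mul] }
  have hm : ∀ (g : Γ) (i j : Fin n),
      (m.toHomUnits g : Matrix (Fin n) (Fin n) (Polynomial F)) i j =
        if d i ≤ d j then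
          X ^ (d j - d i).toNat * C ((ρ g : Matrix (Fin n) (Fin n) F) i j)
        else 0 := fun g i j => rfl
  refine ⟨m.toHomUnits, hm, ?_,
    (Matrix.GeneralLinearGroup.map (evalRingHom (0 : F))).comp m.toHomUnits,
    fun g => rfl, ?_⟩
  · intro g
    ext i j
    rw [Matrix.map_apply, hm]
    split_ifs with h
    · simp
    · simp [htri g i j (not_le.mp h)]
  · intro g i j
    change eval (0 : F) ((m.toHomUnits g : Matrix (Fin n) (Fin n) (Polynomial F)) i j) = _
    rw [hm]
    by_cases h : d i = d j
    · simp [h]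
    · rw [if_neg h]
      split_ifs with h1
      · have : (d j - d i).toNat ≠ 0 := by omega
        simp [this]
      · simp
end

section
/- Let G be a group, K a normal subgroup of G, and V a finite-dimensional complex representation ρ of G. Call a filtration 0 = W_0 ≤ W_1 ≤ ⋯ ≤ W_r = V by ρ(G)-invariant subspaces graded-extendable if for every g ∈ K and every 1 ≤ j ≤ r one has (ρ(g) − id)(W_j) ≤ W_{j−1}, i.e., K acts trivially on each graded piece W_j/W_{j−1}. Then any two graded-extendable filtrations W and W̃ of V are connected by a finite string of graded-extendable filtrations W = W(0), W(1), …, W(a_1) = W̃ such that for each 0 < a ≤ a_1 the consecutive filtrations W(a−1) and W(a) admit a common refinement by ρ(G)-invariant subspaces (equivalently, every member of W(a−1) is comparable under inclusion with every member of W(a)). -/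
/-- A filtration `0 = W 0 ≤ W 1 ≤ ⋯ ≤ W len = V` of a complex representation
`ρ` of `G` by `ρ(G)`-invariant subspaces. -/
structure InvariantFiltration {G V : Type*} [Group G] [AddCommGroup V] [Module ℂ V]
    (ρ : Representation ℂ G V) where
  len : ℕ
  piece : Fin (len + 1) → Submodule ℂ V
  mono : Monotone piece
  bot_eq : piece 0 = ⊥
  top_eq : piece (Fin.last len) = ⊤
  invariant : ∀ (g : G) (i : Fin (len + 1)), (piece i).map (ρ g) ≤ piece i

/-- The set of members (subspaces occurring) of an invariant filtration. -/
def InvariantFiltration.members {G V : Type*} [Group G] [AddCommGroup V] [Module ℂ V]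
    {ρ : Representation ℂ G V} (F : InvariantFiltration ρ) : Set (Submodule ℂ V) :=
  Set.range F.piece

/-- An invariant filtration is graded-extendable (with respect to a normal subgroup
`K ≤ G`) if every `g ∈ K` acts trivially on each graded piece `W j / W (j-1)`,
i.e. `(ρ g - id) (W j) ≤ W (j-1)`. -/
structure GradedExtendableFiltration {G V : Type*} [Group G] [AddCommGroup V]
    [Module ℂ V] (K : Subgroup G) (ρ : Representation ℂ G V) extends
    InvariantFiltration ρ where
  graded : ∀ g ∈ K, ∀ j : Fin len,
    (piece j.succ).map (ρ g - 1 : V →ₗ[ℂ] V) ≤ piece j.castSucc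

namespace GEF

variable {G V : Type*} [Group G] [AddCommGroup V] [Module ℂ V]

/-- Two filtrations admit a common invariant refinement. -/
def Adj {K : Subgroup G} {ρ : Representation ℂ G V}
    (X Y : GradedExtendableFiltration K ρ) : Prop :=
  ∃ T : InvariantFiltration ρ,
    X.toInvariantFiltration.members ⊆ T.members ∧ Y.toInvariantFiltration.members ⊆ T.members

/-- An `ℕ`-indexed invariant filtration. -/
structure Inv (ρ : Representation ℂ G V) (f : ℕ → Submodule ℂ V) (N : ℕ) : Prop where
  mono : Monotone f
  bot : f 0 = ⊥
  top : f N = ⊤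
  inv : ∀ (g : G) (i : ℕ) (v : V), v ∈ f i → ρ g v ∈ f i

/-- The shift condition. -/
def Sh (K : Subgroup G) (ρ : Representation ℂ G V) (f f' : ℕ → Submodule ℂ V) : Prop :=
  ∀ g ∈ K, ∀ (j : ℕ) (v : V), v ∈ f' (j + 1) → ρ g v - v ∈ f j

/-- Truncation of an `ℕ`-indexed filtration. -/
def mkI {ρ : Representation ℂ G V} {f : ℕ → Submodule ℂ V} {N : ℕ} (h : Inv ρ f N) :
    InvariantFiltration ρ where
  len := N
  piece := fun i => f i
  mono := fun i j hij => h.mono hij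
  bot_eq := h.bot
  top_eq := h.top
  invariant := by
    rintro g i _ ⟨v, hv, rfl⟩
    exact h.inv g i v hv

/-- Truncation of an `ℕ`-indexed graded-extendable filtration. -/
def mkG {K : Subgroup G} {ρ : Representation ℂ G V} {f : ℕ → Submodule ℂ V} {N : ℕ}
    (h : Inv ρ f N) (h' : Sh K ρ f f) : GradedExtendableFiltration K ρ where
  toInvariantFiltration := mkI h
  graded := by
    rintro g hg j _ ⟨v, hv, rfl⟩
    exact h' g hg j v hv

variable {K : Subgroup G} {ρ : Representation ℂ G V}

lemma mem_mkI {f : ℕ → Submodule ℂ V} {N : ℕ} (h : Inv ρ f N) (P : Submodule ℂ V) :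
    P ∈ (mkI h).members ↔ ∃ j ≤ N, f j = P := by
  constructor
  · rintro ⟨i, rfl⟩
    exact ⟨i, Nat.lt_succ_iff.1 i.2, rfl⟩
  · rintro ⟨j, hj, rfl⟩
    exact ⟨⟨j, Nat.lt_succ_iff.2 hj⟩, rfl⟩

lemma adj_symm {X Y : GradedExtendableFiltration K ρ} (h : Adj X Y) : Adj Y X := by
  obtain ⟨T, h1, h2⟩ := h
  exact ⟨T, h2, h1⟩

lemma adj_of_subset {X Y : GradedExtendableFiltration K ρ}
    (h : X.toInvariantFiltration.members ⊆ Y.toInvariantFiltration.members) : Adj X Y :=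
  ⟨Y.toInvariantFiltration, h, subset_rfl⟩

lemma adj_of_agree {f f' : ℕ → Submodule ℂ V} {N : ℕ} (h : Inv ρ f N) (hs : Sh K ρ f f)
    (h' : Inv ρ f' N) (hs' : Sh K ρ f' f') (e : ∀ j ≤ N, f j = f' j) :
    Adj (mkG h hs) (mkG h' hs') := by
  apply adj_of_subset
  intro P hP
  obtain ⟨j, hj, rfl⟩ := (mem_mkI h P).1 hP
  exact (mem_mkI h' _).2 ⟨j, hj, (e j hj).symm⟩

/-- The interpolation. -/
def E (f f' : ℕ → Submodule ℂ V) (i j : ℕ) : Submodule ℂ V := if j ≤ i then f j else f' j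

section
variable {f f' : ℕ → Submodule ℂ V} {N : ℕ}

lemma E_inv (h : Inv ρ f N) (h' : Inv ρ f' N) (hle : ∀ j, f j ≤ f' j) (i : ℕ) :
    Inv ρ (E f f' i) N where
  mono := by
    intro a b hab
    unfold E
    split_ifs
    · exact h.mono hab
    · exact (hle a).trans (h'.mono hab)
    · omega
    · exact h'.mono hab
  bot := by simp [E, h.bot]
  top := by unfold E; split_ifs; exacts [h.top, h'.top]
  inv := by
    intro g j v
    unfold E; split_ifs; exacts [h.inv g j v, h'.inv g j v]

lemma E_sh (hle : ∀ j, f j ≤ f' j) (hs : Sh K ρ f f') (i : ℕ) :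
    Sh K ρ (E f f' i) (E f f' i) := by
  intro g hg j v hv
  have hv' : v ∈ f' (j + 1) := by
    unfold E at hv
    split_ifs at hv
    · exact hle _ hv
    · exact hv
  have := hs g hg j v hv'
  unfold E
  split_ifs
  · exact this
  · exact hle _ this

lemma E_adj (h : Inv ρ f N) (h' : Inv ρ f' N) (hle : ∀ j, f j ≤ f' j) (hs : Sh K ρ f f')
    (i : ℕ) : Adj (mkG (E_inv h h' hle i) (E_sh hle hs i))
      (mkG (E_inv h h' hle (i + 1)) (E_sh hle hs (i + 1))) := by
  have hT : Inv ρ (fun j => if j ≤ i + 1 then f j else f' (j - 1)) (N + 1) := by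
    refine ⟨?_, ?_, ?_, ?_⟩
    · intro a b hab
      dsimp only
      split_ifs
      · exact h.mono hab
      · exact (h.mono (by omega : a ≤ i + 1)).trans ((hle _).trans (h'.mono (by omega)))
      · omega
      · exact h'.mono (by omega)
    · simp [h.bot]
    · split_ifs
      · exact top_le_iff.1 (h.top ▸ h.mono (Nat.le_succ N))
      · exact h'.top
    · intro g j v
      split_ifs
      exacts [h.inv g j v, h'.inv g _ v]
  refine ⟨mkI hT, ?_, ?_⟩
  · intro P hP
    obtain ⟨j, hj, rfl⟩ := (mem_mkI (E_inv h h' hle i) P).1 hP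
    rw [mem_mkI]
    by_cases hji : j ≤ i
    · exact ⟨j, by omega, by simp [E, hji, (by omega : j ≤ i + 1)]⟩
    · exact ⟨j + 1, by omega, by simp [E, hji]⟩
  · intro P hP
    obtain ⟨j, hj, rfl⟩ := (mem_mkI (E_inv h h' hle (i + 1)) P).1 hP
    rw [mem_mkI]
    by_cases hji : j ≤ i + 1
    · exact ⟨j, by omega, by simp [E, hji]⟩
    · exact ⟨j + 1, by omega, by
        have h2 : ¬ j ≤ i := by omega
        simp [E, hji, h2]⟩

lemma conn_step (h : Inv ρ f N) (h' : Inv ρ f' N) (hle : ∀ j, f j ≤ f' j) (hs : Sh K ρ f f')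
    (hf : Sh K ρ f f) (hf' : Sh K ρ f' f') :
    Relation.ReflTransGen Adj (mkG h hf) (mkG h' hf') := by
  have key : ∀ i, Relation.ReflTransGen Adj (mkG (E_inv h h' hle i) (E_sh hle hs i))
      (mkG h' hf') := by
    intro i
    induction i with
    | zero =>
      refine .single (adj_of_agree _ _ _ _ ?_)
      intro j _
      unfold E
      split_ifs with hj
      · obtain rfl : j = 0 := by omega
        rw [h.bot, h'.bot]
      · rfl
    | succ i ih => exact .head (adj_symm (E_adj h h' hle hs i)) ih
  refine .head (adj_of_agree _ _ _ _ ?_) (key N)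
  intro j hj
  simp [E, hj]

end

/-- The canonical ascending filtration by iterated `K`-invariants. -/
def S (K : Subgroup G) (ρ : Representation ℂ G V) : ℕ → Submodule ℂ V
  | 0 => ⊥
  | n + 1 => ⨅ g : K, (S K ρ n).comap (ρ g - 1 : V →ₗ[ℂ] V)

lemma mem_S_succ (n : ℕ) (v : V) : v ∈ S K ρ (n + 1) ↔ ∀ g ∈ K, ρ g v - v ∈ S K ρ n := by
  simp [S, Submodule.mem_iInf]

lemma S_inv (hK : K.Normal) (g : G) (n : ℕ) : ∀ v, v ∈ S K ρ n → ρ g v ∈ S K ρ n := by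
  induction n with
  | zero => intro v hv; simp only [S, Submodule.mem_bot] at hv ⊢; simp [hv]
  | succ n ih =>
    intro v hv
    rw [mem_S_succ] at hv ⊢
    intro k hk
    have h1 := ih _ (hv (g⁻¹ * k * g) (by simpa using hK.conj_mem k hk g⁻¹))
    have e : ρ g (ρ (g⁻¹ * k * g) v) = ρ k (ρ g v) := by
      rw [← Module.End.mul_apply, ← Module.End.mul_apply, ← map_mul, ← map_mul]
      congr 2
      group
    rwa [map_sub, e] at h1

lemma S_mono (hK : K.Normal) : Monotone (S K ρ) := by
  refine monotone_nat_of_le_succ fun n v hv => ?_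
  rw [mem_S_succ]
  exact fun g _ => sub_mem (S_inv hK g n v hv) hv

lemma S_sh : Sh K ρ (S K ρ) (S K ρ) := fun g hg j v hv => (mem_S_succ j v).1 hv g hg

lemma le_S {f : ℕ → Submodule ℂ V} (h0 : f 0 = ⊥) (hf : Sh K ρ f f) (j : ℕ) :
    f j ≤ S K ρ j := by
  induction j with
  | zero => simp [h0]
  | succ j ih =>
    intro v hv
    rw [mem_S_succ]
    exact fun g hg => ih (hf g hg j v hv)

lemma S_Inv (hK : K.Normal) {f : ℕ → Submodule ℂ V} {N : ℕ} (h : Inv ρ f N)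
    (hf : Sh K ρ f f) : Inv ρ (S K ρ) N :=
  ⟨S_mono hK, rfl, top_le_iff.1 (h.top ▸ le_S h.bot hf N), fun g i => S_inv hK g i⟩

/-- Intermediate filtrations between `f` and the canonical one. -/
def F (K : Subgroup G) (ρ : Representation ℂ G V) (f : ℕ → Submodule ℂ V) (k j : ℕ) :
    Submodule ℂ V := f j ⊔ S K ρ (min j k)

lemma F_Inv (hK : K.Normal) {f : ℕ → Submodule ℂ V} {N : ℕ} (h : Inv ρ f N) (k : ℕ) :
    Inv ρ (F K ρ f k) N where
  mono := fun a b hab => sup_le_sup (h.mono hab) (S_mono hK (by omega))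
  bot := by simp [F, h.bot, S]
  top := by simp [F, h.top]
  inv := by
    intro g i v hv
    obtain ⟨a, ha, b, hb, rfl⟩ := Submodule.mem_sup.1 hv
    rw [map_add]
    exact Submodule.add_mem_sup (h.inv g i a ha) (S_inv hK g _ b hb)

lemma F_sh_succ {f : ℕ → Submodule ℂ V} (hf : Sh K ρ f f) (k : ℕ) :
    Sh K ρ (F K ρ f k) (F K ρ f (k + 1)) := by
  intro g hg j v hv
  obtain ⟨a, ha, b, hb, rfl⟩ := Submodule.mem_sup.1 hv
  rw [map_add, add_sub_add_comm]
  rw [show min (j + 1) (k + 1) = min j k + 1 by omega] at hb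
  exact Submodule.add_mem_sup (hf g hg j a ha) (S_sh g hg _ b hb)

lemma F_le (hK : K.Normal) (f : ℕ → Submodule ℂ V) (k j : ℕ) :
    F K ρ f k j ≤ F K ρ f (k + 1) j := sup_le_sup le_rfl (S_mono hK (by omega))

lemma F_sh (hK : K.Normal) {f : ℕ → Submodule ℂ V} (hf : Sh K ρ f f) (k : ℕ) :
    Sh K ρ (F K ρ f k) (F K ρ f k) :=
  fun g hg j v hv => F_sh_succ hf k g hg j v (F_le hK f k _ hv)

lemma conn_S (hK : K.Normal) {f : ℕ → Submodule ℂ V} {N : ℕ} (h : Inv ρ f N)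
    (hf : Sh K ρ f f) (hS : Inv ρ (S K ρ) N) :
    Relation.ReflTransGen Adj (mkG h hf) (mkG hS S_sh) := by
  have key : ∀ k, Relation.ReflTransGen Adj (mkG h hf)
      (mkG (F_Inv hK h k) (F_sh hK hf k)) := by
    intro k
    induction k with
    | zero => exact .single (adj_of_agree _ _ _ _ fun j _ => by simp [F, S])
    | succ k ih =>
      exact ih.trans (conn_step _ _ (F_le hK f k) (F_sh_succ hf k) _ _)
  refine (key N).tail (adj_of_agree _ _ _ _ fun j hj => ?_)
  simp [F, hj, le_S h.bot hf j]

/-- The padding of a filtration. -/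
def pad (W : GradedExtendableFiltration K ρ) (j : ℕ) : Submodule ℂ V :=
  W.piece ⟨min j W.len, by omega⟩

lemma pad_Inv (W : GradedExtendableFiltration K ρ) {N : ℕ} (hN : W.len ≤ N) :
    Inv ρ (pad W) N where
  mono := fun a b hab => W.mono (by simp only [Fin.mk_le_mk]; omega)
  bot := by
    rw [← W.bot_eq]; unfold pad; congr 1
  top := by
    rw [← W.top_eq]; unfold pad; congr 1; ext; simp [hN]
  inv := fun g i v hv => W.invariant g _ ⟨v, hv, rfl⟩

lemma pad_sh (W : GradedExtendableFiltration K ρ) : Sh K ρ (pad W) (pad W) := by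
  intro g hg j v hv
  by_cases hj : j < W.len
  · have hv' : v ∈ W.piece (Fin.succ ⟨j, hj⟩) := by
      convert hv using 1
      unfold pad; congr 1; ext; simp; omega
    have := W.graded g hg ⟨j, hj⟩ ⟨v, hv', rfl⟩
    have e : pad W j = W.piece (Fin.castSucc ⟨j, hj⟩) := by
      unfold pad; congr 1; ext; simp; omega
    rw [e]
    simpa using this
  · have e : pad W j = ⊤ := by
      rw [← W.top_eq]; unfold pad; congr 1; ext; simp; omega
    rw [e]; trivial

lemma adj_pad (W : GradedExtendableFiltration K ρ) {N : ℕ} (hN : W.len ≤ N) :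
    Adj W (mkG (pad_Inv W hN) (pad_sh W)) := by
  apply adj_of_subset
  rintro _ ⟨i, rfl⟩
  refine (mem_mkI (pad_Inv W hN) _).2 ⟨i, by omega, ?_⟩
  unfold pad; congr 1; ext; simp; omega

lemma exists_chain {α : Type*} {r : α → α → Prop} {x y : α} (h : Relation.ReflTransGen r x y) :
    ∃ (n : ℕ) (c : Fin (n + 1) → α), c 0 = x ∧ c (Fin.last n) = y ∧
      ∀ a : Fin n, r (c a.castSucc) (c a.succ) := by
  induction h with
  | refl => exact ⟨0, fun _ => x, rfl, rfl, fun a => a.elim0⟩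
  | @tail b z _ hbz ih =>
    obtain ⟨n, c, h0, h1, hc⟩ := ih
    refine ⟨n + 1, Fin.snoc (α := fun _ => α) c z, ?_, ?_, ?_⟩
    · rw [← Fin.castSucc_zero, Fin.snoc_castSucc, h0]
    · rw [Fin.snoc_last]
    · intro a
      refine Fin.lastCases ?_ (fun a => ?_) a
      · rw [Fin.snoc_castSucc, Fin.succ_last, Fin.snoc_last, h1]
        exact hbz
      · rw [Fin.snoc_castSucc, Fin.succ_castSucc, Fin.snoc_castSucc]
        exact hc a

end GEF

/-- Any two graded-extendable filtrations of a finite-dimensional complex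
representation of `G` (with respect to a normal subgroup `K`) are connected by a
finite string of graded-extendable filtrations in which any two consecutive
filtrations admit a common refinement by `ρ(G)`-invariant subspaces. -/
theorem gradedExtendable_filtrations_connected
    {G V : Type*} [Group G] [AddCommGroup V] [Module ℂ V] [FiniteDimensional ℂ V]
    (K : Subgroup G) (hK : K.Normal) (ρ : Representation ℂ G V)
    (W W' : GradedExtendableFiltration K ρ) :
    ∃ (a₁ : ℕ) (chain : Fin (a₁ + 1) → GradedExtendableFiltration K ρ),
      chain 0 = W ∧ chain (Fin.last a₁) = W' ∧
      ∀ a : Fin a₁, ∃ T : InvariantFiltration ρ,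
        (chain a.castSucc).toInvariantFiltration.members ⊆ T.members ∧
        (chain a.succ).toInvariantFiltration.members ⊆ T.members := by
  have hN : W.len ≤ max W.len W'.len := le_max_left _ _
  have hN' : W'.len ≤ max W.len W'.len := le_max_right _ _
  have hS := GEF.S_Inv hK (GEF.pad_Inv W hN) (GEF.pad_sh W)
  have c1 := Relation.ReflTransGen.head (GEF.adj_pad W hN)
    (GEF.conn_S hK (GEF.pad_Inv W hN) (GEF.pad_sh W) hS)
  have c2 := Relation.ReflTransGen.head (GEF.adj_pad W' hN')
    (GEF.conn_S hK (GEF.pad_Inv W' hN') (GEF.pad_sh W') hS)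
  have c3 := (@Relation.ReflTransGen.stdSymm _ _ ⟨fun _ _ h => GEF.adj_symm h⟩).symm _ _ c2
  exact GEF.exists_chain (c1.trans c3)
end
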